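/- Let c > 0 and d > 0, and let μ = Γ'(d)/Γ(d) − Γ'(c)/Γ(c). Then (Γ(c+d)/(Γ(c)Γ(d))) · ∫₀¹ (log((1−x)/x))² · x^{c−1} (1−x)^{d−1} dx − μ² = (Γ(d)Γ''(d) − Γ'(d)²)/Γ(d)² + (Γ(c)Γ''(c) − Γ'(c)²)/Γ(c)². Equivalently, if θ is a random angle in [0, π/2] with cos²θ distributed as Beta(c,d), then the variance of log(tan²θ) equals (Γ(d)Γ''(d) − Γ'(d)²)/Γ(d)² + (Γ(c)Γ''(c) − Γ'(c)²)/Γ(c)². -/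

import Mathlib

open Real intervalIntegral

open MeasureTheory ProbabilityTheory Set Filter Topology

/-- The real Gamma function is analytic on the positive half-line. -/
theorem Real.analyticAt_Gamma_of_pos {s : ℝ} (hs : 0 < s) : AnalyticAt ℝ Real.Gamma s := by
  have hd : DifferentiableOn ℂ Complex.Gamma {z | 0 < z.re} := fun z hz ↦
    (Complex.differentiableAt_Gamma z fun m h ↦ by
      have hz' : 0 < z.re := hz
      have hm : (0 : ℝ) ≤ m := m.cast_nonneg
      rw [h] at hz'
      simp at hz'
      linarith).differentiableWithinAt
  have ha : AnalyticAt ℂ Complex.Gamma s :=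
    hd.analyticAt ((isOpen_lt continuous_const Complex.continuous_re).mem_nhds (by simpa using hs))
  refine ha.re_ofReal.congr (Eventually.of_forall fun x ↦ ?_)
  simp [Complex.Gamma_ofReal]

/-- Tilting the beta density by `exp (t * log ((1 - x) / x))` gives a multiple of the beta density
with parameters `c - t` and `d + t`. -/
theorem betaPDFReal_mul_exp_log_odds {c d t : ℝ} (hct : t < c) (hdt : -d < t) (x : ℝ) :
    betaPDFReal c d x * exp (t * log ((1 - x) / x)) =
      beta (c - t) (d + t) / beta c d * betaPDFReal (c - t) (d + t) x := by
  have hb : beta (c - t) (d + t) ≠ 0 := (beta_pos (by linarith) (by linarith)).ne'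
  unfold betaPDFReal
  split_ifs with hx
  · obtain ⟨h0, h1⟩ := hx
    have h1' : 0 < 1 - x := by linarith
    rw [log_div h1'.ne' h0.ne', rpow_def_of_pos h0, rpow_def_of_pos h1', rpow_def_of_pos h0,
      rpow_def_of_pos h1']
    have key : exp (log x * (c - 1)) * exp (log (1 - x) * (d - 1)) *
        exp (t * (log (1 - x) - log x)) =
        exp (log x * (c - t - 1)) * exp (log (1 - x) * (d + t - 1)) := by
      simp only [← exp_add]
      congr 1
      ring
    calc _ = 1 / beta c d * (exp (log x * (c - 1)) * exp (log (1 - x) * (d - 1)) *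
          exp (t * (log (1 - x) - log x))) := by ring
      _ = _ := by
        rw [key]
        field_simp
  · simp

theorem lintegral_exp_log_odds_betaMeasure {c d t : ℝ} (hc : 0 < c) (hd : 0 < d)
    (hct : t < c) (hdt : -d < t) :
    ∫⁻ x, ENNReal.ofReal (exp (t * log ((1 - x) / x))) ∂betaMeasure c d =
      ENNReal.ofReal (beta (c - t) (d + t) / beta c d) := by
  have hm (a b : ℝ) : Measurable (betaPDF a b) := (measurable_betaPDFReal a b).ennreal_ofReal
  have hr : 0 ≤ beta (c - t) (d + t) / beta c d :=
    (div_pos (beta_pos (by linarith) (by linarith)) (beta_pos hc hd)).le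
  rw [betaMeasure, lintegral_withDensity_eq_lintegral_mul _ (hm c d) (by fun_prop)]
  calc _ = ∫⁻ x, ENNReal.ofReal (beta (c - t) (d + t) / beta c d) *
        betaPDF (c - t) (d + t) x := by
        refine lintegral_congr fun x ↦ ?_
        rw [Pi.mul_apply, betaPDF, betaPDF, ← ENNReal.ofReal_mul' (exp_pos _).le,
          ← ENNReal.ofReal_mul hr, betaPDFReal_mul_exp_log_odds hct hdt]
    _ = _ := by
        rw [lintegral_const_mul _ (hm _ _),
          lintegral_betaPDF_eq_one (by linarith) (by linarith), mul_one]

theorem integrable_exp_log_odds_betaMeasure {c d t : ℝ} (hc : 0 < c) (hd : 0 < d)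
    (hct : t < c) (hdt : -d < t) :
    Integrable (fun x ↦ exp (t * log ((1 - x) / x))) (betaMeasure c d) := by
  refine ⟨Measurable.aestronglyMeasurable (by fun_prop), ?_⟩
  rw [hasFiniteIntegral_iff_ofReal (Eventually.of_forall fun x ↦ (exp_pos _).le),
    lintegral_exp_log_odds_betaMeasure hc hd hct hdt]
  exact ENNReal.ofReal_lt_top

theorem mgf_log_odds_betaMeasure {c d t : ℝ} (hc : 0 < c) (hd : 0 < d)
    (hct : t < c) (hdt : -d < t) :
    mgf (fun x ↦ log ((1 - x) / x)) (betaMeasure c d) t =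
      beta (c - t) (d + t) / beta c d := by
  rw [mgf, integral_eq_lintegral_of_nonneg_ae (Eventually.of_forall fun x ↦ (exp_pos _).le)
    (Measurable.aestronglyMeasurable (by fun_prop)),
    lintegral_exp_log_odds_betaMeasure hc hd hct hdt, ENNReal.toReal_ofReal]
  exact (div_pos (beta_pos (by linarith) (by linarith)) (beta_pos hc hd)).le

theorem integral_betaMeasure {c d : ℝ} (hc : 0 < c) (hd : 0 < d) (f : ℝ → ℝ) :
    ∫ x, f x ∂betaMeasure c d =
      1 / beta c d * ∫ x in (0 : ℝ)..1, f x * x ^ (c - 1) * (1 - x) ^ (d - 1) := by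
  have hm : Measurable (betaPDF c d) := (measurable_betaPDFReal c d).ennreal_ofReal
  rw [betaMeasure, integral_withDensity_eq_integral_toReal_smul hm
    (Eventually.of_forall fun x ↦ by simp [betaPDF]),
    intervalIntegral.integral_of_le zero_le_one, integral_Ioc_eq_integral_Ioo,
    ← MeasureTheory.integral_const_mul, ← MeasureTheory.integral_indicator measurableSet_Ioo]
  refine integral_congr_ae (Eventually.of_forall fun x ↦ ?_)
  by_cases hx : x ∈ Ioo (0 : ℝ) 1
  · have hp := (betaPDFReal_pos hx.1 hx.2 hc hd).le
    simp only [betaPDF, ENNReal.toReal_ofReal hp, indicator_of_mem hx, smul_eq_mul]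
    rw [betaPDFReal, if_pos ⟨hx.1, hx.2⟩]
    ring
  · have hx' : ¬ (0 < x ∧ x < 1) := hx
    simp [betaPDF, betaPDFReal, hx']

/-- The second derivative at `0` of `t ↦ f (c - t) * g (d + t)`. -/
theorem iteratedDeriv_two_mul_comp_sub_add {f g : ℝ → ℝ} {c d : ℝ}
    (hf : AnalyticAt ℝ f c) (hg : AnalyticAt ℝ g d) :
    iteratedDeriv 2 (fun t ↦ f (c - t) * g (d + t)) 0 =
      deriv (deriv f) c * g d - 2 * (deriv f c * deriv g d) + f c * deriv (deriv g) d := by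
  have hsub {h : ℝ → ℝ} {t : ℝ} (hh : DifferentiableAt ℝ h (c - t)) :
      HasDerivAt (fun t ↦ h (c - t)) (-deriv h (c - t)) t :=
    hh.hasDerivAt.comp_const_sub c t
  have hadd {h : ℝ → ℝ} {t : ℝ} (hh : DifferentiableAt ℝ h (d + t)) :
      HasDerivAt (fun t ↦ h (d + t)) (deriv h (d + t)) t :=
    hh.hasDerivAt.comp_const_add d t
  have tf : Tendsto (fun t : ℝ ↦ c - t) (𝓝 0) (𝓝 c) :=
    Continuous.tendsto' (by fun_prop) _ _ (sub_zero c)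
  have tg : Tendsto (fun t : ℝ ↦ d + t) (𝓝 0) (𝓝 d) :=
    Continuous.tendsto' (by fun_prop) _ _ (add_zero d)
  have h1 : deriv (fun t ↦ f (c - t) * g (d + t)) =ᶠ[𝓝 0]
      fun t ↦ -deriv f (c - t) * g (d + t) + f (c - t) * deriv g (d + t) := by
    filter_upwards [tf.eventually hf.eventually_analyticAt,
      tg.eventually hg.eventually_analyticAt] with t h₁ h₂
    exact ((hsub h₁.differentiableAt).mul (hadd h₂.differentiableAt)).deriv
  rw [iteratedDeriv_succ, iteratedDeriv_one, h1.deriv_eq]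
  have hf0 : AnalyticAt ℝ f (c - 0) := by simpa using hf
  have hg0 : AnalyticAt ℝ g (d + 0) := by simpa using hg
  have h2 := (((hsub hf0.deriv.differentiableAt).neg.mul (hadd hg0.differentiableAt)).add
    ((hsub hf0.differentiableAt).mul (hadd hg0.deriv.differentiableAt))).deriv
  refine h2.trans ?_
  simp only [sub_zero, add_zero, Pi.neg_apply]
  ring

/-- if `cos²θ ~ Beta(c,d)` then the variance of `log(tan²θ)`
equals `ψ'(d) + ψ'(c)` in the form
`(Γ(d)Γ''(d) − Γ'(d)²)/Γ(d)² + (Γ(c)Γ''(c) − Γ'(c)²)/Γ(c)²`, stated as a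
second-moment integral identity. -/
theorem beta_log_tan_sq_variance (c d : ℝ) (hc : 0 < c) (hd : 0 < d)
    (μ : ℝ) (hμ : μ = deriv Real.Gamma d / Real.Gamma d - deriv Real.Gamma c / Real.Gamma c) :
    (Real.Gamma (c + d) / (Real.Gamma c * Real.Gamma d)) *
          (∫ x in (0 : ℝ)..1, (Real.log ((1 - x) / x)) ^ 2 * x ^ (c - 1) * (1 - x) ^ (d - 1))
        - μ ^ 2
      = (Real.Gamma d * deriv (deriv Real.Gamma) d - (deriv Real.Gamma d) ^ 2) /
          (Real.Gamma d) ^ 2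
        + (Real.Gamma c * deriv (deriv Real.Gamma) c - (deriv Real.Gamma c) ^ 2) /
          (Real.Gamma c) ^ 2 := by
  have hΓc := (Real.Gamma_pos_of_pos hc).ne'
  have hΓd := (Real.Gamma_pos_of_pos hd).ne'
  have hΓ := (Real.Gamma_pos_of_pos (add_pos hc hd)).ne'
  have hI : Ioo (-d) c ∈ 𝓝 (0 : ℝ) := Ioo_mem_nhds (by linarith) hc
  have h0 : 0 ∈ interior (integrableExpSet (fun x ↦ log ((1 - x) / x)) (betaMeasure c d)) :=
    mem_interior_iff_mem_nhds.2 (mem_of_superset hI fun t ht ↦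
      integrable_exp_log_odds_betaMeasure hc hd ht.2 ht.1)
  have hmgf : mgf (fun x ↦ log ((1 - x) / x)) (betaMeasure c d) =ᶠ[𝓝 0]
      fun t ↦ (Real.Gamma c * Real.Gamma d)⁻¹ * (Real.Gamma (c - t) * Real.Gamma (d + t)) := by
    filter_upwards [hI] with t ht
    rw [mgf_log_odds_betaMeasure hc hd ht.2 ht.1, beta, beta,
      show c - t + (d + t) = c + d by ring]
    field_simp
  have hmoment := iteratedDeriv_mgf_zero h0 2
  rw [hmgf.iteratedDeriv_eq, iteratedDeriv_const_mul_field,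
    iteratedDeriv_two_mul_comp_sub_add (Real.analyticAt_Gamma_of_pos hc)
      (Real.analyticAt_Gamma_of_pos hd), integral_betaMeasure hc hd, beta, one_div_div] at hmoment
  simp only [Pi.pow_apply] at hmoment
  rw [← hmoment, hμ]
  field_simp
  ring
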